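/- Let (Ω, 𝒜, P) be a probability space and X : Ω × [0,∞) → ℝ^d be jointly measurable with right-continuous paths. Let g : ℝ^d → [0,∞) be bounded, Borel measurable and regular at zero, let λ > 0, and define τ₀(ω) := inf{t ≥ 0 : g(X(ω,t)) = 0} ∈ [0,∞]. Assume: (A1) for every x ∈ ℝ^d with g(x) = 0 there exist C_g > 0 and δ > 0 such that g(y) ≤ C_g |y − x|^λ for all y with |y − x| < δ; and (A2) for P-almost every ω with τ₀(ω) < ∞ there exist C(ω) > 0 and δ(ω) > 0 such that |X(ω, τ₀(ω) + t) − X(ω, τ₀(ω))| ≤ C(ω) t^{1/λ} for all t ∈ [0, δ(ω)]. Then there exists a jointly measurable Z : Ω × [0,∞) → ℝ^d such that for P-almost every ω, Z(ω,t) = X(ω, ∫₀ᵗ g(Z(ω,s)) ds) for all t ≥ 0, and any two such solutions are indistinguishable. -/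

import Mathlib

open MeasureTheory ENNReal

noncomputable def HH (f : ℝ → ℝ≥0∞) (u : ℝ) : ℝ≥0∞ := ∫⁻ v in Set.Ioc 0 u, (f v)⁻¹

noncomputable def AA (f : ℝ → ℝ≥0∞) (t : ℝ) : ℝ := sSup {u : ℝ | HH f u ≤ ENNReal.ofReal t}

lemma HH_mono (f : ℝ → ℝ≥0∞) : Monotone (HH f) := fun _ _ h =>
  lintegral_mono_set (Set.Ioc_subset_Ioc_right h)

lemma HH_nonpos (f : ℝ → ℝ≥0∞) {u : ℝ} (hu : u ≤ 0) : HH f u = 0 := by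
  simp [HH, Set.Ioc_eq_empty (not_lt.2 hu)]

lemma HH_left (f : ℝ → ℝ≥0∞) (c : ℝ≥0∞) (u : ℝ)
    (h : ∀ v < u, HH f v ≤ c) : HH f u ≤ c := by
  have hU : Set.Ioo (0:ℝ) u = ⋃ n : ℕ, Set.Ioc 0 (u - 1 / ((n:ℝ) + 1)) := by
    ext x
    simp only [Set.mem_Ioo, Set.mem_iUnion, Set.mem_Ioc]
    constructor
    · rintro ⟨h0, h1⟩
      obtain ⟨n, hn⟩ := exists_nat_one_div_lt (sub_pos.2 h1)
      exact ⟨n, h0, by linarith⟩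
    · rintro ⟨n, h0, h1⟩
      have : (0:ℝ) < 1 / ((n:ℝ) + 1) := Nat.one_div_pos_of_nat
      exact ⟨h0, by linarith⟩
  have : HH f u = ∫⁻ v in Set.Ioo 0 u, (f v)⁻¹ := by
    unfold HH
    exact (setLIntegral_congr Ioo_ae_eq_Ioc).symm
  rw [this, hU, setLIntegral_iUnion_of_directed]
  · refine iSup_le fun n => h _ ?_
    have : (0:ℝ) < 1 / ((n:ℝ) + 1) := Nat.one_div_pos_of_nat
    linarith
  · refine Monotone.directed_le fun m n hmn => Set.Ioc_subset_Ioc_right ?_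
    have := Nat.one_div_le_one_div (α := ℝ) hmn
    linarith

lemma HH_lower (f : ℝ → ℝ≥0∞) (M : ℝ) (hM : 0 < M)
    (hfM : ∀ v, f v ≤ ENNReal.ofReal M) {u t : ℝ} (ht : 0 ≤ t)
    (h : HH f u ≤ ENNReal.ofReal t) : u ≤ M * t := by
  by_cases hu : u ≤ 0
  · exact hu.trans (by positivity)
  push Not at hu
  have h1 : ENNReal.ofReal (u / M) ≤ HH f u := by
    calc ENNReal.ofReal (u / M) = ∫⁻ v in Set.Ioc 0 u, (ENNReal.ofReal M)⁻¹ := by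
          rw [setLIntegral_const, Real.volume_Ioc, sub_zero, ← ENNReal.ofReal_inv_of_pos hM,
            ← ENNReal.ofReal_mul (by positivity)]
          congr 1; field_simp
      _ ≤ _ := lintegral_mono fun v => ENNReal.inv_le_inv.2 (hfM v)
  have h2 := (ENNReal.ofReal_le_ofReal_iff ht).1 (h1.trans h)
  rw [div_le_iff₀ hM] at h2
  linarith

lemma le_AA (f : ℝ → ℝ≥0∞) (M : ℝ) (hM : 0 < M)
    (hfM : ∀ v, f v ≤ ENNReal.ofReal M) (a t : ℝ) :
    a ≤ AA f t ↔ HH f a ≤ ENNReal.ofReal t := by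
  have ht : ENNReal.ofReal t = ENNReal.ofReal (max t 0) := by
    rcases le_total t 0 with h | h
    · simp [h]
    · simp [h]
  have hb : BddAbove {u : ℝ | HH f u ≤ ENNReal.ofReal t} :=
    ⟨M * max t 0, fun u hu => HH_lower f M hM hfM (le_max_right _ _) (by rw [← ht]; exact hu)⟩
  have hne : {u : ℝ | HH f u ≤ ENNReal.ofReal t}.Nonempty := ⟨0, by simp [HH_nonpos]⟩
  constructor
  · intro ha
    refine (HH_mono f ha).trans (HH_left f _ _ fun v hv => ?_)
    obtain ⟨w, hw, hvw⟩ := exists_lt_of_lt_csSup hne hv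
    exact (HH_mono f hvw.le).trans hw
  · intro h
    exact le_csSup hb h

lemma AA_mono (f : ℝ → ℝ≥0∞) (M : ℝ) (hM : 0 < M)
    (hfM : ∀ v, f v ≤ ENNReal.ofReal M) : Monotone (AA f) := fun s t hst => by
  rw [le_AA f M hM hfM]
  exact ((le_AA f M hM hfM _ s).1 le_rfl).trans (ENNReal.ofReal_le_ofReal hst)

lemma AA_nonneg (f : ℝ → ℝ≥0∞) (M : ℝ) (hM : 0 < M)
    (hfM : ∀ v, f v ≤ ENNReal.ofReal M) (t : ℝ) : 0 ≤ AA f t := by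
  rw [le_AA f M hM hfM]; simp [HH_nonpos]

/-- pushforward of Lebesgue under AA -/
lemma AA_map (f : ℝ → ℝ≥0∞) (hf : Measurable f) (M : ℝ) (hM : 0 < M)
    (hfM : ∀ v, f v ≤ ENNReal.ofReal M) (t : ℝ) (ht : 0 ≤ t) :
    (volume.restrict (Set.Ioc 0 t)).map (AA f) =
      (volume.restrict (Set.Ioc 0 (AA f t))).withDensity (fun v => (f v)⁻¹) +
        (ENNReal.ofReal t - HH f (AA f t)) • Measure.dirac (AA f t) := by
  have hm := (AA_mono f M hM hfM).measurable
  have hHle : HH f (AA f t) ≤ ENNReal.ofReal t := (le_AA f M hM hfM _ t).1 le_rfl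
  refine Measure.ext_of_Ici _ _ fun a => ?_
  rw [Measure.map_apply hm measurableSet_Ici, Measure.restrict_apply (hm measurableSet_Ici),
    Measure.add_apply, withDensity_apply _ measurableSet_Ici,
    Measure.restrict_restrict measurableSet_Ici, Measure.smul_apply,
    Measure.dirac_apply' _ measurableSet_Ici, smul_eq_mul]
  have hset : AA f ⁻¹' Set.Ici a ∩ Set.Ioc 0 t = {s | HH f a ≤ ENNReal.ofReal s} ∩ Set.Ioc 0 t := by
    ext s; simp [le_AA f M hM hfM]
  rw [hset]
  by_cases hat : a ≤ AA f t
  · have hHa : HH f a ≤ ENNReal.ofReal t := (le_AA f M hM hfM _ t).1 hat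
    have hfin : HH f a ≠ ⊤ := ne_top_of_le_ne_top ENNReal.ofReal_ne_top hHa
    have hL : volume ({s | HH f a ≤ ENNReal.ofReal s} ∩ Set.Ioc 0 t) = ENNReal.ofReal t - HH f a := by
      have : ({s | HH f a ≤ ENNReal.ofReal s} ∩ Set.Ioc 0 t) =
          Set.Icc (HH f a).toReal t ∩ Set.Ioc 0 t := by
        ext s
        simp only [Set.mem_inter_iff, Set.mem_ofPred_eq, Set.mem_Ioc, Set.mem_Icc]
        constructor
        · rintro ⟨h, h0, h1⟩
          exact ⟨⟨ENNReal.toReal_le_of_le_ofReal h0.le h, h1⟩, h0, h1⟩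
        · rintro ⟨⟨h, _⟩, h0, h1⟩
          exact ⟨(ENNReal.le_ofReal_iff_toReal_le hfin h0.le).2 h, h0, h1⟩
      rw [this]
      have h2 : (Set.Icc (HH f a).toReal t ∩ Set.Ioc 0 t : Set ℝ) =ᵐ[volume]
          (Set.Ioc (HH f a).toReal t ∩ Set.Ioc 0 t : Set ℝ) :=
        Ioc_ae_eq_Icc.symm.inter (ae_eq_refl _)
      rw [measure_congr h2, Set.Ioc_inter_Ioc, Real.volume_Ioc, max_eq_left ENNReal.toReal_nonneg,
        min_self, ENNReal.ofReal_sub _ ENNReal.toReal_nonneg, ENNReal.ofReal_toReal hfin]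
    have hR : HH f (AA f t) = HH f a + ∫⁻ v in Set.Ici a ∩ Set.Ioc 0 (AA f t), (f v)⁻¹ := by
      have h2 : (Set.Ici a ∩ Set.Ioc 0 (AA f t) : Set ℝ) =ᵐ[volume]
          (Set.Ioi a ∩ Set.Ioc 0 (AA f t) : Set ℝ) :=
        Ioi_ae_eq_Ici.symm.inter (ae_eq_refl _)
      rw [setLIntegral_congr h2]
      unfold HH
      rw [← lintegral_union (by measurability)]
      · congr 2
        ext s
        simp only [Set.mem_Ioc, Set.mem_union, Set.mem_inter_iff, Set.mem_Ioi]
        constructor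
        · rintro ⟨h0, h1⟩
          rcases le_or_gt s a with h | h
          · exact Or.inl ⟨h0, h⟩
          · exact Or.inr ⟨h, h0, h1⟩
        · rintro (⟨h0, h1⟩ | ⟨_, h0, h1⟩)
          · exact ⟨h0, h1.trans hat⟩
          · exact ⟨h0, h1⟩
      · rw [Set.disjoint_left]
        rintro s ⟨_, h1⟩ ⟨h2, _⟩
        exact absurd h1 (not_le.2 h2)
    have hi : (Set.Ici a).indicator (1 : ℝ → ℝ≥0∞) (AA f t) = 1 := by simp [hat]
    rw [hL, hi, mul_one]
    have hfin2 : HH f (AA f t) ≠ ⊤ := ne_top_of_le_ne_top ENNReal.ofReal_ne_top hHle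
    have : ENNReal.ofReal t = HH f (AA f t) + (ENNReal.ofReal t - HH f (AA f t)) :=
      (add_tsub_cancel_of_le hHle).symm
    conv_lhs => rw [this, hR, ← hR, hR, add_assoc, ENNReal.add_sub_cancel_left hfin]
    rw [hR]
  · have hi : (Set.Ici a).indicator (1 : ℝ → ℝ≥0∞) (AA f t) = 0 := by
      simp only [Set.indicator_apply_eq_zero, Set.mem_Ici]; exact fun h => absurd h hat
    have he1 : {s | HH f a ≤ ENNReal.ofReal s} ∩ Set.Ioc 0 t = ∅ := by
      ext s
      simp only [Set.mem_inter_iff, Set.mem_ofPred_eq, Set.mem_Ioc, Set.mem_empty_iff_false,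
        iff_false, not_and]
      intro h h0 h1
      exact hat ((le_AA f M hM hfM _ t).2 (h.trans (ENNReal.ofReal_le_ofReal h1)))
    have he2 : Set.Ici a ∩ Set.Ioc 0 (AA f t) = ∅ := by
      ext s
      simp only [Set.mem_inter_iff, Set.mem_Ici, Set.mem_Ioc, Set.mem_empty_iff_false,
        iff_false, not_and]
      intro h h0 h1
      exact hat (h.trans h1)
    rw [hi, he1, he2]; simp

lemma AA_sol (f : ℝ → ℝ≥0∞) (hf : Measurable f) (M : ℝ) (hM : 0 < M)
    (hfM : ∀ v, f v ≤ ENNReal.ofReal M)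
    (hreg : ∀ u, 0 ≤ u → f u ≠ 0 → ∃ ε > (0:ℝ), ∃ η > (0:ℝ),
      ∀ v ∈ Set.Ico u (u + η), ENNReal.ofReal ε ≤ f v)
    (t : ℝ) (ht : 0 ≤ t) :
    ∫⁻ s in Set.Ioc 0 t, f (AA f s) = ENNReal.ofReal (AA f t) := by
  have hm := (AA_mono f M hM hfM).measurable
  have hHle : HH f (AA f t) ≤ ENNReal.ofReal t := (le_AA f M hM hfM _ t).1 le_rfl
  have hfin2 : HH f (AA f t) ≠ ⊤ := ne_top_of_le_ne_top ENNReal.ofReal_ne_top hHle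
  rw [← lintegral_map hf hm, AA_map f hf M hM hfM t ht, lintegral_add_measure,
    lintegral_smul_measure, lintegral_dirac' _ hf,
    lintegral_withDensity_eq_lintegral_mul _ (show Measurable (fun v => (f v)⁻¹) from hf.inv) hf]
  have h1 : ∫⁻ v in Set.Ioc 0 (AA f t), ((fun v => (f v)⁻¹) * f) v = ENNReal.ofReal (AA f t) := by
    have : ∀ᵐ v ∂(volume.restrict (Set.Ioc 0 (AA f t))), ((fun v => (f v)⁻¹) * f) v = 1 := by
      filter_upwards [ae_lt_top hf.inv hfin2] with v hv
      have h0 : f v ≠ 0 := fun h => by simp [h] at hv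
      exact ENNReal.inv_mul_cancel h0 (ne_top_of_le_ne_top ENNReal.ofReal_ne_top (hfM v))
    rw [lintegral_congr_ae this]
    simp
  rw [h1]
  have h2 : (ENNReal.ofReal t - HH f (AA f t)) • f (AA f t) = 0 := by
    by_contra hne
    rw [smul_eq_mul, mul_eq_zero, not_or] at hne
    obtain ⟨hlt, hfu⟩ := hne
    obtain ⟨ε, hε, η, hη, hb⟩ := hreg _ (AA_nonneg f M hM hfM t) hfu
    set u := AA f t with hu
    have hlt' : HH f u < ENNReal.ofReal t := by
      rw [← tsub_pos_iff_lt]; exact pos_iff_ne_zero.2 hlt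
    have hltr : (HH f u).toReal < t := by
      rwa [← ENNReal.lt_ofReal_iff_toReal_lt hfin2]
    set r := min (η / 2) (ε * (t - (HH f u).toReal)) with hr
    have hr0 : 0 < r := lt_min (by positivity) (mul_pos hε (by linarith))
    have hle : HH f (u + r) ≤ ENNReal.ofReal t := by
      have hsub : Set.Ioc 0 (u + r) ⊆ Set.Ioc 0 u ∪ Set.Ioc u (u + r) := by
        intro s hs
        rcases le_or_gt s u with h | h
        · exact Or.inl ⟨hs.1, h⟩
        · exact Or.inr ⟨h, hs.2⟩
      calc HH f (u + r) ≤ HH f u + ∫⁻ v in Set.Ioc u (u + r), (f v)⁻¹ :=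
            (lintegral_mono_set hsub).trans (lintegral_union_le _ _ _)
        _ ≤ HH f u + ∫⁻ v in Set.Ioc u (u + r), (ENNReal.ofReal ε)⁻¹ := by
            gcongr 1
            refine setLIntegral_mono measurable_const fun v hv => ?_
            refine ENNReal.inv_le_inv.2 (hb v ⟨hv.1.le, ?_⟩)
            have := min_le_left (η / 2) (ε * (t - (HH f u).toReal))
            have := hv.2
            linarith
        _ = ENNReal.ofReal ((HH f u).toReal + ε⁻¹ * r) := by
            rw [setLIntegral_const, Real.volume_Ioc, ← ENNReal.ofReal_inv_of_pos hε,
              ← ENNReal.ofReal_mul (by positivity), ENNReal.ofReal_add ENNReal.toReal_nonneg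
              (by positivity), ENNReal.ofReal_toReal hfin2]
            congr 3; ring
        _ ≤ ENNReal.ofReal t := by
            apply ENNReal.ofReal_le_ofReal
            have := min_le_right (η / 2) (ε * (t - (HH f u).toReal))
            have h3 : ε⁻¹ * r ≤ ε⁻¹ * (ε * (t - (HH f u).toReal)) := by gcongr
            rw [inv_mul_cancel_left₀ hε.ne'] at h3
            linarith
    have := (le_AA f M hM hfM _ t).2 hle
    linarith
  rw [h2, add_zero]

lemma sol_map (f : ℝ → ℝ≥0∞) (hf : Measurable f) (A : ℝ → ℝ) (hA0 : A 0 = 0)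
    (hAm : Measurable A)
    (hAc : ContinuousOn A (Set.Ici 0)) 
    (hA : ∀ a b, 0 ≤ a → a ≤ b → A a ≤ A b ∧ 
      ∫⁻ s in Set.Ioc a b, f (A s) = ENNReal.ofReal (A b - A a)) (t : ℝ) (ht : 0 ≤ t) :
    ((volume.restrict (Set.Ioc 0 t)).withDensity (fun s => f (A s))).map A =
      volume.restrict (Set.Ioc 0 (A t)) := by
  have hfin : IsFiniteMeasure ((volume.restrict (Set.Ioc 0 t)).withDensity (fun s => f (A s))) := by
    apply isFiniteMeasure_withDensity
    rw [(hA 0 t le_rfl ht).2]; exact ENNReal.ofReal_ne_top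
  refine Measure.ext_of_Ici _ _ fun x => ?_
  rw [Measure.map_apply hAm measurableSet_Ici, withDensity_apply _ (hAm measurableSet_Ici),
    Measure.restrict_restrict (hAm measurableSet_Ici), Measure.restrict_apply measurableSet_Ici]
  have hR : volume (Set.Ici x ∩ Set.Ioc 0 (A t)) = ENNReal.ofReal (A t - max x 0) := by
    have h2 : (Set.Ici x ∩ Set.Ioc 0 (A t) : Set ℝ) =ᵐ[volume]
          (Set.Ioi x ∩ Set.Ioc 0 (A t) : Set ℝ) :=
        Ioi_ae_eq_Ici.symm.inter (ae_eq_refl _)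
    have h3 : (Set.Ioi x ∩ Set.Ioc 0 (A t) : Set ℝ) = Set.Ioc (max x 0) (A t) := by
      ext s; simp; tauto
    rw [measure_congr h2, h3, Real.volume_Ioc]
  rw [hR]
  by_cases hx : A t < x
  · have : A ⁻¹' Set.Ici x ∩ Set.Ioc 0 t = ∅ := by
      ext s
      simp only [Set.mem_inter_iff, Set.mem_preimage, Set.mem_Ici, Set.mem_Ioc,
        Set.mem_empty_iff_false, iff_false, not_and]
      intro h h0 h1
      have := (hA s t h0.le h1).1
      linarith
    rw [this, ENNReal.ofReal_of_nonpos]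
    · simp
    · have := le_max_left x 0
      linarith
  push Not at hx
  have hAt : 0 ≤ A t := hA0 ▸ (hA 0 t le_rfl ht).1
  obtain ⟨a, ⟨⟨ha0, hat⟩, haA⟩, hleast⟩ : ∃ a, IsLeast {s | s ∈ Set.Icc 0 t ∧ max x 0 ≤ A s} a := by
    refine IsCompact.exists_isLeast ?_ ⟨t, ⟨ht, le_rfl⟩, max_le hx hAt⟩
    have : {s | s ∈ Set.Icc 0 t ∧ max x 0 ≤ A s} = Set.Icc 0 t ∩ A ⁻¹' Set.Ici (max x 0) := rfl
    rw [this]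
    exact isCompact_Icc.of_isClosed_subset
      ((hAc.mono Set.Icc_subset_Ici_self).preimage_isClosed_of_isClosed isClosed_Icc
      isClosed_Ici) Set.inter_subset_left
  have hAa : A a = max x 0 := by
    obtain ⟨b, ⟨hb0, hba⟩, hb⟩ := intermediate_value_Icc ha0
      (hAc.mono Set.Icc_subset_Ici_self) (show max x 0 ∈ Set.Icc (A 0) (A a) from
        ⟨hA0.le.trans (le_max_right _ _), haA⟩)
    have := hleast ⟨⟨hb0, hba.trans hat⟩, hb.ge⟩
    rw [← hb, le_antisymm hba this]
  have hs : A ⁻¹' Set.Ici x ∩ Set.Ioc 0 t = Set.Icc a t ∩ Set.Ioc 0 t := by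
    ext s
    simp only [Set.mem_inter_iff, Set.mem_preimage, Set.mem_Ici, Set.mem_Ioc, Set.mem_Icc]
    constructor
    · rintro ⟨h, h0, h1⟩
      refine ⟨⟨hleast ⟨⟨h0.le, h1⟩, max_le h ?_⟩, h1⟩, h0, h1⟩
      exact hA0 ▸ (hA 0 s le_rfl h0.le).1
    · rintro ⟨⟨h, _⟩, h0, h1⟩
      refine ⟨?_, h0, h1⟩
      have := (hA a s ha0 h).1
      exact (le_max_left x 0).trans (hAa ▸ this)
  have h2 : (Set.Icc a t ∩ Set.Ioc 0 t : Set ℝ) =ᵐ[volume]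
          (Set.Ioc a t ∩ Set.Ioc 0 t : Set ℝ) :=
        Ioc_ae_eq_Icc.symm.inter (ae_eq_refl _)
  rw [hs, setLIntegral_congr h2, Set.Ioc_inter_Ioc, max_eq_left ha0, min_self,
    (hA a t ha0 hat).2, hAa]

lemma sol_HH (f : ℝ → ℝ≥0∞) (hf : Measurable f) (A : ℝ → ℝ) (hA0 : A 0 = 0)
    (hAm : Measurable A)
    (hAc : ContinuousOn A (Set.Ici 0)) 
    (hA : ∀ a b, 0 ≤ a → a ≤ b → A a ≤ A b ∧ 
      ∫⁻ s in Set.Ioc a b, f (A s) = ENNReal.ofReal (A b - A a)) (t : ℝ) (ht : 0 ≤ t) :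
    HH f (A t) = ∫⁻ s in Set.Ioc 0 t, f (A s) * (f (A s))⁻¹ := by
  unfold HH
  have hfi : Measurable (fun v => (f v)⁻¹) := hf.inv
  have h1 : Measurable (fun v => f (A v)) := hf.comp hAm
  have h2 : Measurable (fun v => (f (A v))⁻¹) := hfi.comp hAm
  rw [← sol_map f hf A hA0 hAm hAc hA t ht, lintegral_map hfi hAm,
    lintegral_withDensity_eq_lintegral_mul _ h1 h2]
  rfl

lemma sol_unique (f : ℝ → ℝ≥0∞) (hf : Measurable f) (M : ℝ) (hM : 0 < M)
    (hfM : ∀ v, f v ≤ ENNReal.ofReal M) (A : ℝ → ℝ) (hA0 : A 0 = 0)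
    (hAm : Measurable A)
    (hAc : ContinuousOn A (Set.Ici 0)) 
    (hA : ∀ a b, 0 ≤ a → a ≤ b → A a ≤ A b ∧ 
      ∫⁻ s in Set.Ioc a b, f (A s) = ENNReal.ofReal (A b - A a))
    (hexp : ∀ v, 0 ≤ v → f v = 0 → ∀ u, v < u → HH f u = ⊤)
    (t : ℝ) (ht : 0 ≤ t) : A t = AA f t := by
  have hH := sol_HH f hf A hA0 hAm hAc hA t ht
  have hle : HH f (A t) ≤ ENNReal.ofReal t := by
    rw [hH]
    calc _ ≤ ∫⁻ s in Set.Ioc 0 t, (1 : ℝ≥0∞) := lintegral_mono fun s => ENNReal.mul_inv_le_one _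
      _ = _ := by simp
  refine le_antisymm ((le_AA f M hM hfM _ t).2 hle) ?_
  by_cases hz : ∃ s ∈ Set.Ioc 0 t, f (A s) = 0
  · obtain ⟨s, hs, hfs⟩ := hz
    by_contra hlt
    push Not at hlt
    have h1 := (hA s t hs.1.le hs.2).1
    have h2 := hexp (A s) (hA0 ▸ (hA 0 s le_rfl hs.1.le).1) hfs (AA f t) (h1.trans_lt hlt)
    have h3 := (le_AA f M hM hfM _ t).1 le_rfl
    rw [h2] at h3
    exact absurd h3 (by simp)
  · push Not at hz
    have heq : HH f (A t) = ENNReal.ofReal t := by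
      rw [hH, setLIntegral_congr_fun (g := fun _ => 1) measurableSet_Ioc]
      · simp
      · intro s hs
        exact ENNReal.mul_inv_cancel (hz s hs) (ne_top_of_le_ne_top ENNReal.ofReal_ne_top (hfM _))
    by_contra hlt
    push Not at hlt
    set u := AA f t
    have hu := (le_AA f M hM hfM u t).1 le_rfl
    have h0 : 0 ≤ A t := hA0 ▸ (hA 0 t le_rfl ht).1
    have hsplit : HH f u = HH f (A t) + ∫⁻ v in Set.Ioc (A t) u, (f v)⁻¹ := by
      unfold HH
      rw [← lintegral_union measurableSet_Ioc, Set.Ioc_union_Ioc_eq_Ioc h0 hlt.le]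
      rw [Set.disjoint_left]
      rintro s ⟨_, h1⟩ ⟨h2, _⟩
      exact absurd h1 (not_le.2 h2)
    rw [hsplit, heq] at hu
    have hz : ∫⁻ v in Set.Ioc (A t) u, (f v)⁻¹ = 0 := by
      have : ENNReal.ofReal t + ∫⁻ v in Set.Ioc (A t) u, (f v)⁻¹ ≤ ENNReal.ofReal t + 0 := by
        simpa using hu
      exact nonpos_iff_eq_zero.1 ((ENNReal.add_le_add_iff_left ENNReal.ofReal_ne_top).1 this)
    have hpos : ∫⁻ v in Set.Ioc (A t) u, (ENNReal.ofReal M)⁻¹ ≤ ∫⁻ v in Set.Ioc (A t) u, (f v)⁻¹ :=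
      lintegral_mono fun v => ENNReal.inv_le_inv.2 (hfM v)
    rw [hz, setLIntegral_const, Real.volume_Ioc, ← ENNReal.ofReal_inv_of_pos hM,
              ← ENNReal.ofReal_mul (by positivity)] at hpos
    have := ENNReal.ofReal_eq_zero.1 (nonpos_iff_eq_zero.1 hpos)
    have h4 : 0 < M⁻¹ * (u - A t) := mul_pos (by positivity) (by linarith)
    linarith

lemma HH_top (f : ℝ → ℝ≥0∞) (τ K η : ℝ) (hτ : 0 ≤ τ) (hK : 0 < K) (hη : 0 < η)
    (hb : ∀ v ∈ Set.Ioc τ (τ + η), f v ≤ ENNReal.ofReal (K * (v - τ))) (u : ℝ) (hu : τ < u) :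
    HH f u = ⊤ := by
  set w := min u (τ + η) with hw
  have hwτ : τ < w := lt_min hu (by linarith)
  have hni : ¬ IntervalIntegrable (fun x => (x - τ)⁻¹) volume τ w := by
    rw [intervalIntegrable_sub_inv_iff]
    push Not
    exact ⟨hwτ.ne, Set.left_mem_uIcc⟩
  have htop : ∫⁻ v in Set.Ioc τ w, ENNReal.ofReal ((v - τ)⁻¹) = ⊤ := by
    by_contra hne
    apply hni
    rw [intervalIntegrable_iff_integrableOn_Ioc_of_le hwτ.le]
    refine ⟨by fun_prop, ?_⟩
    rw [hasFiniteIntegral_iff_ofReal]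
    · exact lt_top_iff_ne_top.2 hne
    · filter_upwards [ae_restrict_mem measurableSet_Ioc] with v hv
      exact inv_nonneg.2 (sub_nonneg.2 hv.1.le)
  have hge : ∫⁻ v in Set.Ioc τ w, ENNReal.ofReal K⁻¹ * ENNReal.ofReal ((v - τ)⁻¹) ≤ HH f u := by
    calc _ ≤ ∫⁻ v in Set.Ioc τ w, (f v)⁻¹ := by
          refine setLIntegral_mono' measurableSet_Ioc fun v hv => ?_
          have h0 : 0 < v - τ := sub_pos.2 hv.1
          rw [← ENNReal.ofReal_mul (by positivity), ← mul_inv,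
            ENNReal.ofReal_inv_of_pos (by positivity)]
          exact ENNReal.inv_le_inv.2 (hb v ⟨hv.1, hv.2.trans (min_le_right _ _)⟩)
      _ ≤ _ := lintegral_mono_set (Set.Ioc_subset_Ioc hτ (min_le_left _ _))
  rw [lintegral_const_mul _ (by fun_prop), htop, ENNReal.mul_top (by simpa using hK)] at hge
  exact top_le_iff.1 hge

lemma reg_path {d : ℕ} (x : ℝ → EuclideanSpace ℝ (Fin d)) 
    (hx_rc : ∀ t, 0 ≤ t → ContinuousWithinAt x (Set.Ici t) t)
    (δ : ℝ) (hδ : 0 < δ) (u : ℝ) (hu : 0 ≤ u) :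
    ∃ η > (0:ℝ), ∀ v ∈ Set.Ico u (u + η), ‖x v - x u‖ < δ := by
  obtain ⟨η, hη, h⟩ := Metric.continuousWithinAt_iff.1 (hx_rc u hu) δ hδ
  refine ⟨η, hη, fun v hv => ?_⟩
  rw [← dist_eq_norm]
  refine h hv.1 ?_
  rw [Real.dist_eq, abs_of_nonneg (sub_nonneg.2 hv.1)]
  linarith [hv.2]

lemma reg_f {d : ℕ} (x : ℝ → EuclideanSpace ℝ (Fin d)) 
    (hx_rc : ∀ t, 0 ≤ t → ContinuousWithinAt x (Set.Ici t) t)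
    (g : EuclideanSpace ℝ (Fin d) → ℝ)
    (hg_reg : ∀ x, 0 < g x →
      ∃ ε > (0:ℝ), ∃ δ > (0:ℝ), ∀ y, ‖y - x‖ < δ → ε < g y) (u : ℝ) (hu : 0 ≤ u)
    (hgu : 0 < g (x u)) :
    ∃ ε > (0:ℝ), ∃ η > (0:ℝ), ∀ v ∈ Set.Ico u (u + η), ε < g (x v) := by
  obtain ⟨ε, hε, δ, hδ, h⟩ := hg_reg _ hgu
  obtain ⟨η, hη, h'⟩ := reg_path x hx_rc δ hδ u hu
  exact ⟨ε, hε, η, hη, fun v hv => h _ (h' v hv)⟩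

lemma explode {d : ℕ} (x : ℝ → EuclideanSpace ℝ (Fin d)) 
    (hx_rc : ∀ t, 0 ≤ t → ContinuousWithinAt x (Set.Ici t) t)
    (g : EuclideanSpace ℝ (Fin d) → ℝ) (hg_nonneg : ∀ x, 0 ≤ g x)
    (hg_reg : ∀ x, 0 < g x →
      ∃ ε > (0:ℝ), ∃ δ > (0:ℝ), ∀ y, ‖y - x‖ < δ → ε < g y)
    (lam : ℝ) (hlam : 0 < lam)
    (hA1 : ∀ x, g x = 0 →
      ∃ C_g > (0:ℝ), ∃ δ > (0:ℝ), ∀ y, ‖y - x‖ < δ → g y ≤ C_g * ‖y - x‖ ^ lam)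
    (hA2 : ∀ τ : ℝ, IsGLB {t : ℝ | 0 ≤ t ∧ g (x t) = 0} τ →
      ∃ C > (0:ℝ), ∃ δ > (0:ℝ), ∀ t ∈ Set.Icc (0:ℝ) δ,
        ‖x (τ + t) - x τ‖ ≤ C * t ^ (1 / lam)) (v : ℝ) (hv : 0 ≤ v) (hgv : g (x v) = 0)
    (u : ℝ) (hvu : v < u) : HH (fun s => ENNReal.ofReal (g (x s))) u = ⊤ := by
  have hglb : IsGLB {t : ℝ | 0 ≤ t ∧ g (x t) = 0} (sInf {t : ℝ | 0 ≤ t ∧ g (x t) = 0}) :=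
    isGLB_csInf ⟨v, hv, hgv⟩ ⟨0, fun t ht => ht.1⟩
  set τ := sInf {t : ℝ | 0 ≤ t ∧ g (x t) = 0}
  have hτ0 : 0 ≤ τ := hglb.2 fun t ht => ht.1
  have hτv : τ ≤ v := hglb.1 ⟨hv, hgv⟩
  have hgτ : g (x τ) = 0 := by
    by_contra hne
    obtain ⟨ε, hε, η, hη, h⟩ := reg_f x hx_rc g hg_reg τ hτ0
      (lt_of_le_of_ne (hg_nonneg _) (Ne.symm hne))
    have : τ + η ≤ τ := hglb.2 fun t ht => by
      by_contra hlt
      push Not at hlt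
      have h1 := h t ⟨hglb.1 ht, hlt⟩
      rw [ht.2] at h1
      linarith
    linarith
  obtain ⟨Cg, hCg, δ, hδ, h1⟩ := hA1 _ hgτ
  obtain ⟨C, hC, δ', hδ', h2⟩ := hA2 τ hglb
  obtain ⟨η, hη, h3⟩ := reg_path x hx_rc δ hδ τ hτ0
  refine HH_top _ τ (Cg * C ^ lam) (min δ' (η / 2)) hτ0 (by positivity)
    (lt_min hδ' (by positivity)) ?_ u (hτv.trans_lt hvu)
  intro w hw
  have e1 := min_le_left δ' (η / 2)
  have e2 := min_le_right δ' (η / 2)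
  have hw1 := hw.1
  have hw2 := hw.2
  have hw0 : 0 ≤ w - τ := by linarith
  apply ENNReal.ofReal_le_ofReal
  have h4 := h2 (w - τ) ⟨hw0, by linarith⟩
  rw [add_sub_cancel] at h4
  calc g (x w) ≤ Cg * ‖x w - x τ‖ ^ lam := h1 _ (h3 w ⟨hw1.le, by linarith⟩)
    _ ≤ Cg * (C * (w - τ) ^ (1 / lam)) ^ lam := by gcongr
    _ = Cg * C ^ lam * (w - τ) := by
      rw [Real.mul_rpow hC.le (by positivity), ← Real.rpow_mul hw0, one_div,
        inv_mul_cancel₀ hlam.ne', Real.rpow_one, mul_assoc]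

lemma lint_eq (q : ℝ → ℝ) (hq : Measurable q) (hq0 : ∀ s, 0 ≤ q s) (M : ℝ) (hqM : ∀ s, q s ≤ M)
    (a b : ℝ) (hab : a ≤ b) : 
    IntervalIntegrable q volume a b ∧ 
    ∫⁻ s in Set.Ioc a b, ENNReal.ofReal (q s) = ENNReal.ofReal (∫ s in a..b, q s) := by
  have hi : IntegrableOn q (Set.Ioc a b) := by
    refine Measure.integrableOn_of_bounded (M := M) (by simp) hq.aestronglyMeasurable ?_
    exact Filter.Eventually.of_forall fun s => by
      rw [Real.norm_of_nonneg (hq0 s)]; exact hqM s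
  refine ⟨(intervalIntegrable_iff_integrableOn_Ioc_of_le hab).2 hi, ?_⟩
  rw [intervalIntegral.integral_of_le hab, ofReal_integral_eq_lintegral_ofReal hi]
  exact Filter.Eventually.of_forall hq0

/-- under the growth condition (A1) on `g` at its zeros and the
Hölder-type path condition (A2) at `τ₀(ω) = inf{t ≥ 0 : g(X(ω,t)) = 0}` (its
finiteness being expressed via a real greatest lower bound `τ`), the time
change equation `(X, g)` has a jointly measurable solution which is unique up
to indistinguishability. -/
theorem stmt_15 {Ω : Type*} [MeasurableSpace Ω] (P : Measure Ω)
    [IsProbabilityMeasure P] (d : ℕ) (X : Ω → ℝ → EuclideanSpace ℝ (Fin d))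
    (hX_meas : Measurable fun p : Ω × ℝ => X p.1 p.2)
    (hX_rc : ∀ ω, ∀ t, 0 ≤ t → ContinuousWithinAt (X ω) (Set.Ici t) t)
    (g : EuclideanSpace ℝ (Fin d) → ℝ) (hg_nonneg : ∀ x, 0 ≤ g x)
    (hg_bdd : ∃ M : ℝ, ∀ x, g x ≤ M) (hg_meas : Measurable g)
    (hg_reg : ∀ x, 0 < g x →
      ∃ ε > (0:ℝ), ∃ δ > (0:ℝ), ∀ y, ‖y - x‖ < δ → ε < g y)
    (lam : ℝ) (hlam : 0 < lam)
    (hA1 : ∀ x, g x = 0 →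
      ∃ C_g > (0:ℝ), ∃ δ > (0:ℝ), ∀ y, ‖y - x‖ < δ → g y ≤ C_g * ‖y - x‖ ^ lam)
    (hA2 : ∀ᵐ ω ∂P, ∀ τ : ℝ, IsGLB {t : ℝ | 0 ≤ t ∧ g (X ω t) = 0} τ →
      ∃ C > (0:ℝ), ∃ δ > (0:ℝ), ∀ t ∈ Set.Icc (0:ℝ) δ,
        ‖X ω (τ + t) - X ω τ‖ ≤ C * t ^ (1 / lam)) :
    ∃ Z : Ω → ℝ → EuclideanSpace ℝ (Fin d),
      Measurable (fun p : Ω × ℝ => Z p.1 p.2) ∧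
      (∀ᵐ ω ∂P, ∀ t, 0 ≤ t → Z ω t = X ω (∫ s in (0:ℝ)..t, g (Z ω s))) ∧
      (∀ Z₁ Z₂ : Ω → ℝ → EuclideanSpace ℝ (Fin d),
        Measurable (fun p : Ω × ℝ => Z₁ p.1 p.2) →
        Measurable (fun p : Ω × ℝ => Z₂ p.1 p.2) →
        (∀ᵐ ω ∂P, ∀ t, 0 ≤ t → Z₁ ω t = X ω (∫ s in (0:ℝ)..t, g (Z₁ ω s))) →
        (∀ᵐ ω ∂P, ∀ t, 0 ≤ t → Z₂ ω t = X ω (∫ s in (0:ℝ)..t, g (Z₂ ω s))) →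
        ∀ᵐ ω ∂P, ∀ t, 0 ≤ t → Z₁ ω t = Z₂ ω t) := by
  
  obtain ⟨M₀, hM₀⟩ := hg_bdd
  set M := max M₀ 1 with hMdef
  have hM : 0 < M := lt_max_of_lt_right one_pos
  have hgM : ∀ x, g x ≤ M := fun x => (hM₀ x).trans (le_max_left _ _)
  set F : Ω → ℝ → ℝ≥0∞ := fun ω s => ENNReal.ofReal (g (X ω s)) with hF
  have hFm : Measurable (fun p : Ω × ℝ => F p.1 p.2) :=
    ENNReal.measurable_ofReal.comp (hg_meas.comp hX_meas)
  have hFω : ∀ ω, Measurable (F ω) := fun ω => hFm.comp measurable_prodMk_left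
  have hFM : ∀ ω v, F ω v ≤ ENNReal.ofReal M := fun ω v => ENNReal.ofReal_le_ofReal (hgM _)
  have hAm : Measurable (fun p : Ω × ℝ => AA (F p.1) p.2) := by
    refine measurable_of_Ici fun a => ?_
    have : (fun p : Ω × ℝ => AA (F p.1) p.2) ⁻¹' Set.Ici a =
        {p : Ω × ℝ | HH (F p.1) a ≤ ENNReal.ofReal p.2} := by
      ext p; exact le_AA (F p.1) M hM (hFM p.1) a p.2
    rw [this]
    refine measurableSet_le ?_ (ENNReal.measurable_ofReal.comp measurable_snd)
    have h1 : Measurable (fun ω => HH (F ω) a) := by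
      unfold HH
      exact Measurable.lintegral_prod_right' (f := fun p : Ω × ℝ => (F p.1 p.2)⁻¹) hFm.inv
    exact h1.comp measurable_fst
  have huniq : ∀ᵐ ω ∂P, ∀ z : ℝ → EuclideanSpace ℝ (Fin d), Measurable z →
      (∀ t, 0 ≤ t → z t = X ω (∫ s in (0:ℝ)..t, g (z s))) →
      ∀ t, 0 ≤ t → z t = X ω (AA (F ω) t) := by
    filter_upwards [hA2] with ω hω z hz hsol t ht
    have hq : Measurable (fun s => g (z s)) := hg_meas.comp hz
    have hii : ∀ a b, IntervalIntegrable (fun s => g (z s)) volume a b := by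
      intro a b
      rcases le_total a b with h | h
      · exact (lint_eq _ hq (fun s => hg_nonneg _) M (fun s => hgM _) a b h).1
      · exact (lint_eq _ hq (fun s => hg_nonneg _) M (fun s => hgM _) b a h).1.symm
    have hc : Continuous (fun t => ∫ s in (0:ℝ)..t, g (z s)) :=
      intervalIntegral.continuous_primitive hii 0
    rw [hsol t ht]
    congr 1
    refine sol_unique (F ω) (hFω ω) M hM (hFM ω) (fun t => ∫ s in (0:ℝ)..t, g (z s)) (by simp)
      hc.measurable hc.continuousOn ?_ ?_ t ht
    · intro a b ha hab
      have hsub := intervalIntegral.integral_interval_sub_left (hii 0 b) (hii 0 a)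
      have hnn : 0 ≤ ∫ s in a..b, g (z s) :=
        intervalIntegral.integral_nonneg hab fun s _ => hg_nonneg _
      refine ⟨by linarith, ?_⟩
      simp only [hsub]
      rw [← (lint_eq _ hq (fun s => hg_nonneg _) M (fun s => hgM _) a b hab).2]
      refine setLIntegral_congr_fun measurableSet_Ioc fun s hs => ?_
      simp only [hF]
      rw [← hsol s (ha.trans hs.1.le)]
    · intro v hv hfv u hvu
      refine explode (X ω) (hX_rc ω) g hg_nonneg hg_reg lam hlam hA1 hω v hv ?_ u hvu
      exact le_antisymm (ENNReal.ofReal_eq_zero.1 hfv) (hg_nonneg _)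
  refine ⟨fun ω t => X ω (AA (F ω) t), hX_meas.comp (measurable_fst.prodMk hAm), ?_, ?_⟩
  · refine Filter.Eventually.of_forall fun ω t ht => ?_
    simp only
    congr 1
    have hA := AA_sol (F ω) (hFω ω) M hM (hFM ω) ?_ t ht
    · have hm : Measurable (fun s => g (X ω (AA (F ω) s))) :=
        hg_meas.comp ((hX_meas.comp (measurable_fst.prodMk hAm)).comp
          (measurable_prodMk_left (x := ω)))
      have h2 := (lint_eq _ hm (fun s => hg_nonneg _) M (fun s => hgM _) 0 t ht).2
      have h3 := h2.symm.trans hA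
      exact ((ENNReal.ofReal_eq_ofReal_iff (intervalIntegral.integral_nonneg ht
        fun s _ => hg_nonneg _) (AA_nonneg _ M hM (hFM ω) t)).1 h3).symm
    · intro u hu hfu
      obtain ⟨ε, hε, η, hη, h⟩ := reg_f (X ω) (hX_rc ω) g hg_reg u hu
        (by by_contra h; exact hfu (ENNReal.ofReal_eq_zero.2 (not_lt.1 h)))
      exact ⟨ε, hε, η, hη, fun v hv => ENNReal.ofReal_le_ofReal (h v hv).le⟩
  · intro Z₁ Z₂ hZ₁ hZ₂ h₁ h₂
    filter_upwards [huniq, h₁, h₂] with ω hu h1 h2 t ht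
    rw [hu (Z₁ ω) (hZ₁.comp measurable_prodMk_left) h1 t ht,
      hu (Z₂ ω) (hZ₂.comp measurable_prodMk_left) h2 t ht]
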